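/- Let n be a natural number and p₁, …, p_n real numbers with 0 ≤ p_i ≤ 1 for each i and Σ_{i=1}^n p_i ≤ 1. Then Σ_{i=1}^n p_i / (1 − p_i + p_i²) ≤ 4/3. -/

import Mathlib

theorem div_one_sub_add_sq_le {x : ℝ} (hx : 0 ≤ x) :
    x / (1 - x + x ^ 2) ≤ 4 / 3 * x := by
  have h : 3 / 4 ≤ 1 - x + x ^ 2 := by nlinarith [sq_nonneg (x - 1 / 2)]
  rw [div_le_iff₀ (by linarith)]
  nlinarith [mul_le_mul_of_nonneg_left h hx]

theorem stmt_5 (n : ℕ) (p : Fin n → ℝ) (hp : ∀ i, 0 ≤ p i ∧ p i ≤ 1)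
    (hsum : ∑ i, p i ≤ 1) :
    ∑ i, p i / (1 - p i + (p i) ^ 2) ≤ 4 / 3 := by
  calc ∑ i, p i / (1 - p i + (p i) ^ 2) ≤ ∑ i, 4 / 3 * p i :=
        Finset.sum_le_sum fun i _ => div_one_sub_add_sq_le (hp i).1
    _ = 4 / 3 * ∑ i, p i := by rw [Finset.mul_sum]
    _ ≤ 4 / 3 := by linarith
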